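/- Suppose a finite set S ⊂ ℝ^D lies within the closed ball B(x₀, Δ). Pick any 0 < δ < 2/e² and a random vector U distributed as N(0, (1/D)·I_D). Then with probability at least 1 − δ over the choice of U, |median({U·z : z ∈ S}) − U·x₀| ≤ (Δ/√D)·√(2·ln(2/δ)). -/

import Mathlib

open MeasureTheory ProbabilityTheory Finset
open scoped NNReal

/-- The distribution `N(0, (1/D)·I_D)` on `ℝ^D`: `D` independent coordinates, each
Gaussian with mean `0` and variance `1/D`. -/
noncomputable def gaussPi (D : ℕ) : Measure (Fin D → ℝ) :=
  Measure.pi fun _ => gaussianReal 0 (D : ℝ≥0)⁻¹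

theorem isProbabilityMeasure_gaussPi (D : ℕ) : IsProbabilityMeasure (gaussPi D) := by
  unfold gaussPi
  infer_instance

/-- A linear functional of the random vector `U ∼ N(0, (1/D)·I_D)` is a centered Gaussian
with standard deviation `‖w‖ / √D`. -/
theorem gaussPi_map_sum_mul {D : ℕ} (w : EuclideanSpace ℝ (Fin D)) :
    (gaussPi D).map (fun u => ∑ i, u i * w i) =
      (gaussianReal 0 1).map (fun x => ‖w‖ / Real.sqrt D * x) := by
  have hf (i : Fin D) : AEMeasurable (fun x : ℝ => x * w i)
      (gaussianReal 0 (D : ℝ≥0)⁻¹) := by fun_prop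
  have : IsProbabilityMeasure (gaussPi D) := isProbabilityMeasure_gaussPi D
  refine Measure.ext_of_charFun (funext fun t => ?_)
  rw [gaussPi, (iIndepFun_pi hf).charFun_map_fun_sum_eq_prod (fun i => Measurable.aemeasurable (by fun_prop)),
    gaussianReal_map_const_mul, charFun_gaussianReal, Finset.prod_apply]
  have h (i : Fin D) : charFun ((Measure.pi fun _ : Fin D => gaussianReal 0 (D : ℝ≥0)⁻¹).map
      (fun u => u i * w i)) t = Complex.exp (-((D : ℂ)⁻¹ * (w i : ℂ) ^ 2 * (t : ℂ) ^ 2 / 2)) := by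
    have : (fun u : Fin D → ℝ => u i * w i) = (fun x => x * w i) ∘ Function.eval i := rfl
    rw [this, ← Measure.map_map (by fun_prop) (by fun_prop),
      (measurePreserving_eval (fun _ : Fin D => gaussianReal 0 (D : ℝ≥0)⁻¹) i).map_eq,
      gaussianReal_map_mul_const, charFun_gaussianReal]
    congr 1
    simp only [NNReal.coe_mul, NNReal.coe_mk, NNReal.coe_inv, NNReal.coe_natCast]
    push_cast
    ring
  rw [Finset.prod_congr rfl fun i _ => h i, ← Complex.exp_sum]
  have hnorm : (‖w‖ : ℂ) ^ 2 = ∑ i, (w i : ℂ) ^ 2 := by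
    exact_mod_cast EuclideanSpace.real_norm_sq_eq w
  have hD : ((Real.sqrt D : ℝ) : ℂ) ^ 2 = D := by
    exact_mod_cast Real.sq_sqrt (Nat.cast_nonneg D)
  congr 1
  simp only [mul_one, NNReal.coe_mk]
  push_cast
  rw [div_pow, hnorm, hD, Finset.sum_neg_distrib, ← Finset.sum_div, ← Finset.sum_mul,
    ← Finset.mul_sum]
  ring

/-- One-sided tail bound for the standard Gaussian distribution. -/
theorem gaussianReal_Ioi_le {t : ℝ} (ht : 1 ≤ t) :
    gaussianReal 0 1 (Set.Ioi t) ≤ ENNReal.ofReal (Real.exp (-t ^ 2 / 2) / 2) := by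
  have hderiv (x : ℝ) : HasDerivAt (fun y => -Real.exp (-y ^ 2 / 2))
      (x * Real.exp (-x ^ 2 / 2)) x := by
    have h : HasDerivAt (fun y : ℝ => -y ^ 2 / 2) (-x) x := by
      exact ((hasDerivAt_pow 2 x).fun_neg.div_const 2).congr_deriv (by norm_num; ring)
    exact h.exp.fun_neg.congr_deriv (by ring)
  have hlim : Filter.Tendsto (fun y : ℝ => -Real.exp (-y ^ 2 / 2)) Filter.atTop (nhds 0) := by
    rw [← neg_zero]
    refine (Real.tendsto_exp_atBot.comp ?_).neg
    have : Filter.Tendsto (fun y : ℝ => y ^ 2 / 2) Filter.atTop Filter.atTop :=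
      (Filter.tendsto_pow_atTop two_ne_zero).atTop_div_const two_pos
    simpa only [neg_div, Function.comp_def] using Filter.tendsto_neg_atTop_atBot.comp this
  have hnonneg (x : ℝ) (hx : x ∈ Set.Ioi t) : 0 ≤ x * Real.exp (-x ^ 2 / 2) :=
    mul_nonneg (by linarith [Set.mem_Ioi.1 hx]) (Real.exp_pos _).le
  have hint := integrableOn_Ioi_deriv_of_nonneg' (fun x _ => hderiv x) hnonneg hlim
  have heq := integral_Ioi_of_hasDerivAt_of_nonneg' (fun x _ => hderiv x) hnonneg hlim
  have hsqrt : 2 ≤ Real.sqrt (2 * Real.pi) :=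
    Real.le_sqrt_of_sq_le (by nlinarith [Real.pi_gt_three])
  rw [gaussianReal_apply_eq_integral 0 one_ne_zero]
  refine ENNReal.ofReal_le_ofReal ?_
  calc ∫ x in Set.Ioi t, gaussianPDFReal 0 1 x
      ≤ ∫ x in Set.Ioi t, 2⁻¹ * (x * Real.exp (-x ^ 2 / 2)) := by
        refine setIntegral_mono_on (integrable_gaussianPDFReal 0 1).integrableOn
          (hint.const_mul _) measurableSet_Ioi fun x hx => ?_
        have hx1 : 1 ≤ x := ht.trans (Set.mem_Ioi.1 hx).le
        simp only [gaussianPDFReal_def, NNReal.coe_one, mul_one, sub_zero]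
        gcongr
        exact le_mul_of_one_le_left (Real.exp_pos _).le hx1
    _ = Real.exp (-t ^ 2 / 2) / 2 := by
        rw [integral_const_mul, heq]
        ring

/-- Two-sided tail bound for the standard Gaussian distribution. -/
theorem gaussianReal_lt_abs_le {t : ℝ} (ht : 1 ≤ t) :
    gaussianReal 0 1 {x | t < |x|} ≤ ENNReal.ofReal (Real.exp (-t ^ 2 / 2)) := by
  have hneg : gaussianReal 0 1 ((fun x => -x) ⁻¹' Set.Ioi t) = gaussianReal 0 1 (Set.Ioi t) := by
    rw [← Measure.map_apply measurable_neg measurableSet_Ioi, gaussianReal_map_neg, neg_zero]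
  have hset : {x : ℝ | t < |x|} = Set.Ioi t ∪ (fun x => -x) ⁻¹' Set.Ioi t := by
    ext x
    simp only [Set.mem_ofPred_eq, lt_abs, Set.mem_union, Set.mem_Ioi, Set.mem_preimage]
  rw [hset, ← add_halves (Real.exp _),
    ENNReal.ofReal_add (by positivity) (by positivity)]
  refine (measure_union_le _ _).trans (add_le_add (gaussianReal_Ioi_le ht) ?_)
  exact hneg.trans_le (gaussianReal_Ioi_le ht)

/-- Tail bound for the projection of a vector of norm at most `Δ` onto `U ∼ N(0, (1/D)·I_D)`. -/
theorem gaussPi_lt_abs_sum_mul_le {D : ℕ} {w : EuclideanSpace ℝ (Fin D)} {Δ : ℝ} (hw : ‖w‖ ≤ Δ)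
    {t : ℝ} (ht : 1 ≤ t) :
    gaussPi D {u | Δ / Real.sqrt D * t < |∑ i, u i * w i|} ≤
      ENNReal.ofReal (Real.exp (-t ^ 2 / 2)) := by
  have hmeas : MeasurableSet {y : ℝ | Δ / Real.sqrt D * t < |y|} :=
    measurableSet_lt measurable_const (by fun_prop)
  have hpre : {u : Fin D → ℝ | Δ / Real.sqrt D * t < |∑ i, u i * w i|} =
      (fun u => ∑ i, u i * w i) ⁻¹' {y : ℝ | Δ / Real.sqrt D * t < |y|} := rfl
  rw [hpre, ← Measure.map_apply (by fun_prop) hmeas, gaussPi_map_sum_mul,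
    Measure.map_apply (by fun_prop) hmeas]
  refine (measure_mono fun x hx => ?_).trans (gaussianReal_lt_abs_le ht)
  have hΔ : 0 ≤ Δ := (norm_nonneg w).trans hw
  have hx' : Δ / Real.sqrt D * t < |‖w‖ / Real.sqrt D * x| := hx
  rw [abs_mul, abs_of_nonneg (by positivity)] at hx'
  refine lt_of_mul_lt_mul_left (hx'.trans_le ?_) (by positivity : 0 ≤ Δ / Real.sqrt D)
  gcongr

/-- If each of finitely many events has probability at most `p`, then at least half of them occur
simultaneously with probability at most `2 * p`. -/
theorem measure_half_card_le {Ω ι : Type*} [MeasurableSpace Ω] (μ : Measure Ω) (S : Finset ι)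
    (hS : S.Nonempty) (P : ι → Ω → Prop) [∀ ω, DecidablePred fun i => P i ω]
    (hP : ∀ i ∈ S, MeasurableSet {ω | P i ω}) (p : ENNReal) (hp : ∀ i ∈ S, μ {ω | P i ω} ≤ p) :
    μ {ω | S.card ≤ 2 * (S.filter fun i => P i ω).card} ≤ 2 * p := by
  have hcount (ω : Ω) : ((S.filter fun i => P i ω).card : ENNReal) =
      ∑ i ∈ S, {ω | P i ω}.indicator 1 ω := by
    simp [Set.indicator_apply]
  have hmeas : ∀ i ∈ S, Measurable ({ω | P i ω}.indicator (1 : Ω → ENNReal)) :=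
    fun i hi => measurable_one.indicator (hP i hi)
  have hset : {ω | S.card ≤ 2 * (S.filter fun i => P i ω).card} =
      {ω | (S.card : ENNReal) ≤ 2 * ∑ i ∈ S, {ω | P i ω}.indicator 1 ω} := by
    ext ω
    simp only [Set.mem_ofPred_eq, ← hcount]
    exact_mod_cast Iff.rfl
  have hsum : Measurable fun ω => ∑ i ∈ S, {ω | P i ω}.indicator (1 : Ω → ENNReal) ω :=
    Finset.measurable_fun_sum S hmeas
  have hS0 : (S.card : ENNReal) ≠ 0 := by exact_mod_cast hS.card_ne_zero
  rw [hset, ← ENNReal.mul_le_mul_iff_right hS0 (ENNReal.natCast_ne_top _)]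
  refine (mul_meas_ge_le_lintegral (hsum.const_mul 2) _).trans ?_
  rw [lintegral_const_mul 2 hsum, lintegral_finsetSum S hmeas, mul_left_comm]
  gcongr
  rw [← nsmul_eq_mul]
  refine Finset.sum_le_card_nsmul S _ p fun i hi => ?_
  rw [lintegral_indicator_one (hP i hi)]
  exact hp i hi

/-- if a finite set `S ⊆ B(x₀, Δ)` and `0 < δ < 2/e²`, then with
probability at least `1 − δ` over `U ∼ N(0,(1/D)I_D)`, every median `m` of the
projected points `{U·z : z ∈ S}` satisfies `|m − U·x₀| ≤ (Δ/√D)·√(2 ln(2/δ))`.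
A median is any `m` such that at least half the points project `≤ m` and at least
half project `≥ m`. -/
theorem median_near_center {D : ℕ} (hD : 0 < D)
    (x₀ : EuclideanSpace ℝ (Fin D)) (Δ : ℝ)
    (S : Finset (EuclideanSpace ℝ (Fin D))) (hSne : S.Nonempty)
    (hS : ↑S ⊆ Metric.closedBall x₀ Δ)
    (δ : ℝ) (hδ0 : 0 < δ) (hδ1 : δ < 2 / Real.exp 2) :
    1 - ENNReal.ofReal δ ≤
      gaussPi D {u | ∀ m : ℝ,
        ((S.card : ℝ) ≤ 2 * (S.filter fun z => (∑ i, u i * z i) ≤ m).card) →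
        ((S.card : ℝ) ≤ 2 * (S.filter fun z => m ≤ ∑ i, u i * z i).card) →
        |m - ∑ i, u i * x₀ i| ≤ Δ / Real.sqrt D * Real.sqrt (2 * Real.log (2 / δ))} := by
  classical
  set t := Real.sqrt (2 * Real.log (2 / δ)) with ht_def
  have hlog : 2 < Real.log (2 / δ) := by
    rw [Real.lt_log_iff_exp_lt (by positivity)]
    rwa [lt_div_comm₀ (Real.exp_pos 2) hδ0]
  have ht : 1 ≤ t := Real.le_sqrt_of_sq_le (by linarith)
  have hexp : Real.exp (-t ^ 2 / 2) = δ / 2 := by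
    have h : -t ^ 2 / 2 = -Real.log (2 / δ) := by
      rw [ht_def, Real.sq_sqrt (by linarith)]
      ring
    rw [h, Real.exp_neg, Real.exp_log (by positivity), inv_div]
  have hbad := measure_half_card_le (gaussPi D) S hSne
    (fun z u => Δ / Real.sqrt D * t < |∑ i, u i * (z - x₀) i|)
    (fun z _ => measurableSet_lt measurable_const (by fun_prop))
    (ENNReal.ofReal (δ / 2))
    (fun z hz => hexp ▸ gaussPi_lt_abs_sum_mul_le (mem_closedBall_iff_norm.1 (hS hz)) ht)
  have hδ2 : 2 * ENNReal.ofReal (δ / 2) = ENNReal.ofReal δ := by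
    rw [← ENNReal.ofReal_ofNat, ← ENNReal.ofReal_mul (by norm_num)]
    congr 1
    ring
  rw [hδ2] at hbad
  have : IsProbabilityMeasure (gaussPi D) := isProbabilityMeasure_gaussPi D
  rw [tsub_le_iff_right, ← measure_univ (μ := gaussPi D)]
  refine le_trans (measure_mono fun u _ => ?_)
    ((measure_union_le _ _).trans (add_le_add_right hbad _))
  by_contra hu
  rw [Set.mem_union, not_or] at hu
  obtain ⟨hu₁, hu₂⟩ := hu
  refine hu₁ fun m hle hge => ?_
  by_contra! hm
  have hsub (z : EuclideanSpace ℝ (Fin D)) :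
      ∑ i, u i * (z - x₀) i = ∑ i, u i * z i - ∑ i, u i * x₀ i := by
    simp [mul_sub]
  refine hu₂ ?_
  rcases lt_abs.1 hm with h | h
  · have hmono : (S.filter fun z => m ≤ ∑ i, u i * z i).card ≤
        (S.filter fun z => Δ / Real.sqrt D * t < |∑ i, u i * (z - x₀) i|).card := by
      refine Finset.card_le_card (Finset.monotone_filter_right S fun z _ hz => ?_)
      rw [hsub, lt_abs]
      left
      linarith
    have : S.card ≤ 2 * (S.filter fun z => m ≤ ∑ i, u i * z i).card := by exact_mod_cast hge
    exact this.trans (by gcongr)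
  · have hmono : (S.filter fun z => ∑ i, u i * z i ≤ m).card ≤
        (S.filter fun z => Δ / Real.sqrt D * t < |∑ i, u i * (z - x₀) i|).card := by
      refine Finset.card_le_card (Finset.monotone_filter_right S fun z _ hz => ?_)
      rw [hsub, lt_abs]
      right
      linarith
    have : S.card ≤ 2 * (S.filter fun z => ∑ i, u i * z i ≤ m).card := by exact_mod_cast hle
    exact this.trans (by gcongr)
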